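/- arXiv:1810.08657 — 2 statements merged into one kernel-verified Lean document; each statement's English description precedes it below -/
import Mathlib

section
/- Let n and r be integers with n ≥ 5 and 2 ≤ r ≤ n − 3. Then every finite simple graph G of order n with CR(G) = 1 and γ_CR(G) = r satisfies |E(G)| ≥ n − r + 1, and there exists a finite simple graph G of order n with CR(G) = 1, γ_CR(G) = r, and |E(G)| = n − r + 1. In other words, m(n,1,r) = n − r + 1. -/
open SimpleGraph Set

/-- The closed neighborhood `N[v]` of a vertex `v`. -/
def closedNbhd {V : Type*} (G : SimpleGraph V) (v : V) : Set V :=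
  insert v (G.neighborSet v)

/-- `S` is a dominating set of `G`: every vertex lies in `N[s]` for some `s ∈ S`. -/
def IsDomSet {V : Type*} (G : SimpleGraph V) (S : Set V) : Prop :=
  ∀ v : V, ∃ s ∈ S, v ∈ closedNbhd G s

/-- `CR(S)`: the number of vertices overdominated by `S`, i.e. with `|N[x] ∩ S| ≥ 2`. -/
noncomputable def crOf {V : Type*} (G : SimpleGraph V) (S : Set V) : ℕ :=
  {x : V | 2 ≤ (closedNbhd G x ∩ S).ncard}.ncard

/-- `CR(G)`: the minimum of `CR(S)` over all dominating sets `S` of `G`. -/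
noncomputable def crNum {V : Type*} (G : SimpleGraph V) : ℕ :=
  sInf {k : ℕ | ∃ S : Set V, IsDomSet G S ∧ crOf G S = k}

/-- `γ_CR(G)`: the minimum cardinality of a dominating set `S` with `CR(S) = CR(G)`. -/
noncomputable def gammaCR {V : Type*} (G : SimpleGraph V) : ℕ :=
  sInf {r : ℕ | ∃ S : Set V, IsDomSet G S ∧ crOf G S = crNum G ∧ S.ncard = r}

lemma one_le_crOf_iff {V : Type*} [Finite V] (G : SimpleGraph V) (S : Set V) :
    1 ≤ crOf G S ↔
      ∃ x, ∃ a ∈ closedNbhd G x ∩ S, ∃ b ∈ closedNbhd G x ∩ S, a ≠ b := by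
  unfold crOf
  rw [Nat.one_le_iff_ne_zero, ← Nat.pos_iff_ne_zero, Set.ncard_pos (Set.toFinite _)]
  refine exists_congr fun x => ?_
  change 1 < _ ↔ _
  exact Set.one_lt_ncard

lemma mem_closedNbhd_iff {V : Type*} (G : SimpleGraph V) (v w : V) :
    w ∈ closedNbhd G v ↔ w = v ∨ G.Adj v w := by
  simp [closedNbhd]

/-- A dominating set that overdominates some vertex forces more than `|V \ S|` edges. -/
lemma ncard_compl_lt_ncard_edgeSet {V : Type*} [Finite V] (G : SimpleGraph V) (S : Set V)
    (hS : IsDomSet G S) (h : 1 ≤ crOf G S) : Sᶜ.ncard + 1 ≤ G.edgeSet.ncard := by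
  have hdom : ∀ v, ∃ s, v ∉ S → s ∈ S ∧ G.Adj v s := by
    intro v
    obtain ⟨s, hs, hv⟩ := hS v
    rw [mem_closedNbhd_iff] at hv
    refine ⟨s, fun hvS => ⟨hs, ?_⟩⟩
    rcases hv with rfl | hv
    · exact absurd hs hvS
    · exact hv.symm
  choose g hg using hdom
  have hedge : ∃ x s, s ∈ S ∧ G.Adj x s ∧ (x ∉ S → s ≠ g x) := by
    obtain ⟨x, a, ⟨hax, haS⟩, b, ⟨hbx, hbS⟩, hab⟩ := (one_le_crOf_iff G S).1 h
    rw [mem_closedNbhd_iff] at hax hbx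
    by_cases hx : x ∈ S
    · rcases hax with rfl | hax
      · exact ⟨a, b, hbS, hbx.resolve_left (Ne.symm hab), fun h => absurd hx h⟩
      · exact ⟨x, a, haS, hax, fun h => absurd hx h⟩
    · have hax' := hax.resolve_left (by rintro rfl; exact hx haS)
      have hbx' := hbx.resolve_left (by rintro rfl; exact hx hbS)
      by_cases hag : a = g x
      · exact ⟨x, b, hbS, hbx', fun _ hb => hab (hag.trans hb.symm)⟩
      · exact ⟨x, a, haS, hax', fun _ => hag⟩
  obtain ⟨x, s, hsS, hxs, hne⟩ := hedge
  have hinj : Set.InjOn (fun v => s(v, g v)) Sᶜ := by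
    intro v hv w hw hvw
    rcases Sym2.eq_iff.1 hvw with ⟨h, _⟩ | ⟨h, _⟩
    · exact h
    · exact absurd (h ▸ (hg w hw).1) hv
  have hnot : s(x, s) ∉ (fun v => s(v, g v)) '' Sᶜ := by
    rintro ⟨v, hv, hvx⟩
    rcases Sym2.eq_iff.1 hvx with ⟨rfl, h⟩ | ⟨rfl, _⟩
    · exact hne hv h.symm
    · exact hv hsS
  rw [← hinj.ncard_image, ← Set.ncard_insert_of_notMem hnot (Set.toFinite _)]
  refine Set.ncard_le_ncard ?_ (Set.toFinite _)
  rintro e (rfl | ⟨v, hv, rfl⟩)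
  · exact hxs
  · exact (hg v hv).2

lemma exists_domSet_of_gammaCR {V : Type*} (G : SimpleGraph V) :
    ∃ S : Set V, IsDomSet G S ∧ crOf G S = crNum G ∧ S.ncard = gammaCR G := by
  obtain ⟨S, hS, hcr⟩ : crNum G ∈ {k : ℕ | ∃ S : Set V, IsDomSet G S ∧ crOf G S = k} :=
    Nat.sInf_mem ⟨_, Set.univ, fun v => ⟨v, trivial, by simp [closedNbhd]⟩, rfl⟩
  exact Nat.sInf_mem
    (s := {r : ℕ | ∃ S : Set V, IsDomSet G S ∧ crOf G S = crNum G ∧ S.ncard = r})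
    ⟨_, S, hS, hcr, rfl⟩

lemma sub_gammaCR_lt_ncard_edgeSet {V : Type*} [Fintype V] (G : SimpleGraph V)
    (h : crNum G = 1) : Fintype.card V - gammaCR G + 1 ≤ G.edgeSet.ncard := by
  obtain ⟨S, hS, hcr, hcard⟩ := exists_domSet_of_gammaCR G
  have h1 := ncard_compl_lt_ncard_edgeSet G S hS (by omega)
  have h2 := Set.ncard_add_ncard_compl S
  rw [Nat.card_eq_fintype_card] at h2
  omega

/-- The star with centre `0` and leaves `2, …, m - 1`, with the pendant edge `{1, 2}` attached;
all vertices from `m` on are isolated. -/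
def pendantStar (n m : ℕ) : SimpleGraph (Fin n) :=
  SimpleGraph.fromRel fun i j =>
    (i.val = 0 ∧ 2 ≤ j.val ∧ j.val < m) ∨ (i.val = 1 ∧ j.val = 2)

lemma mem_closedNbhd_pendantStar {n m : ℕ} (i j : Fin n) :
    j ∈ closedNbhd (pendantStar n m) i ↔ j.val = i.val ∨
      (i.val = 0 ∧ 2 ≤ j.val ∧ j.val < m) ∨ (i.val = 1 ∧ j.val = 2) ∨
      (j.val = 0 ∧ 2 ≤ i.val ∧ i.val < m) ∨ (j.val = 1 ∧ i.val = 2) := by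
  rw [mem_closedNbhd_iff, pendantStar, SimpleGraph.fromRel_adj, Ne, Fin.ext_iff, Fin.ext_iff]
  omega

lemma ncard_setOf_le_val (n m : ℕ) : {i : Fin n | m ≤ i.val}.ncard = n - m := by
  rw [← Set.ncard_image_of_injective _ Fin.val_injective]
  have : Fin.val '' {i : Fin n | m ≤ i.val} = ↑(Finset.Ico m n) := by
    ext k
    simp only [Set.mem_image, Set.mem_ofPred_eq, Finset.coe_Ico, Set.mem_Ico]
    exact ⟨fun ⟨i, hi, hk⟩ => hk ▸ ⟨hi, i.2⟩, fun ⟨h1, h2⟩ => ⟨⟨k, h2⟩, h1, rfl⟩⟩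
  rw [this, Set.ncard_coe_finset, Nat.card_Ico]

lemma ncard_insert_insert_setOf_le_val {n m : ℕ} (a b : Fin n) (hab : a ≠ b)
    (ha : a.val < m) (hb : b.val < m) :
    (insert a (insert b {i : Fin n | m ≤ i.val})).ncard = n - m + 2 := by
  rw [Set.ncard_insert_of_notMem, Set.ncard_insert_of_notMem, ncard_setOf_le_val]
  · simpa using hb
  · simp [hab, ha]

lemma IsDomSet.pendantStar_cases {n m : ℕ} (hm : 5 ≤ m) (hmn : m ≤ n) {T : Set (Fin n)}
    (hT : IsDomSet (pendantStar n m) T) :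
    (∀ i : Fin n, m ≤ i.val → i ∈ T) ∧
      (⟨1, by omega⟩ ∈ T ∨ ⟨2, by omega⟩ ∈ T) ∧
      (⟨0, by omega⟩ ∈ T ∨ (⟨3, by omega⟩ ∈ T ∧ ⟨4, by omega⟩ ∈ T)) := by
  have key : ∀ v : Fin n, ∃ s ∈ T, _ := fun v => by
    obtain ⟨s, hs, h⟩ := hT v
    exact ⟨s, hs, (mem_closedNbhd_pendantStar s v).1 h⟩
  have hmem : ∀ (s : Fin n) (k : ℕ) (hk : k < n), s ∈ T → s.val = k → (⟨k, hk⟩ : Fin n) ∈ T := by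
    rintro s k hk hs rfl
    exact hs
  refine ⟨fun i hi => ?_, ?_, ?_⟩
  · obtain ⟨s, hs, h⟩ := key i
    exact hmem s i.val i.2 hs (by omega)
  · obtain ⟨s, hs, h⟩ := key ⟨1, by omega⟩
    simp only at h
    by_cases h1 : s.val = 1
    · exact Or.inl (hmem s 1 _ hs h1)
    · exact Or.inr (hmem s 2 _ hs (by omega))
  · obtain ⟨s, hs, h⟩ := key ⟨3, by omega⟩
    obtain ⟨t, ht, h'⟩ := key ⟨4, by omega⟩
    simp only at h h'
    by_cases h1 : s.val = 0
    · exact Or.inl (hmem s 0 _ hs h1)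
    by_cases h2 : t.val = 0
    · exact Or.inl (hmem t 0 _ ht h2)
    · exact Or.inr ⟨hmem s 3 _ hs (by omega), hmem t 4 _ ht (by omega)⟩

lemma IsDomSet.one_le_crOf_pendantStar {n m : ℕ} (hm : 5 ≤ m) (hmn : m ≤ n) {T : Set (Fin n)}
    (hT : IsDomSet (pendantStar n m) T) : 1 ≤ crOf (pendantStar n m) T := by
  obtain ⟨-, h12, h0⟩ := hT.pendantStar_cases hm hmn
  have key : ∀ x a b : Fin n, a ∈ T → b ∈ T → a ∈ closedNbhd (pendantStar n m) x →
      b ∈ closedNbhd (pendantStar n m) x → a ≠ b → 1 ≤ crOf (pendantStar n m) T :=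
    fun x a b ha hb hax hbx hab =>
      (one_le_crOf_iff _ _).2 ⟨x, a, ⟨hax, ha⟩, b, ⟨hbx, hb⟩, hab⟩
  rcases h0 with h0 | ⟨h3, h4⟩
  · rcases h12 with h1 | h2
    · refine key ⟨2, by omega⟩ _ _ h0 h1 ?_ ?_ (by simp) <;>
        simp [mem_closedNbhd_pendantStar] <;> omega
    · refine key ⟨0, by omega⟩ _ _ h0 h2 ?_ ?_ (by simp) <;>
        simp [mem_closedNbhd_pendantStar] <;> omega
  · refine key ⟨0, by omega⟩ _ _ h3 h4 ?_ ?_ (by simp) <;>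
      simp [mem_closedNbhd_pendantStar] <;> omega

lemma IsDomSet.le_ncard_pendantStar {n m : ℕ} (hm : 5 ≤ m) (hmn : m ≤ n) {T : Set (Fin n)}
    (hT : IsDomSet (pendantStar n m) T) : n - m + 2 ≤ T.ncard := by
  obtain ⟨hi, h12, h0⟩ := hT.pendantStar_cases hm hmn
  have key : ∀ a b : Fin n, a ∈ T → b ∈ T → a ≠ b → a.val < m → b.val < m →
      n - m + 2 ≤ T.ncard := by
    intro a b ha hb hab ham hbm
    rw [← ncard_insert_insert_setOf_le_val a b hab ham hbm]
    refine Set.ncard_le_ncard ?_ (Set.toFinite _)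
    rintro x (rfl | rfl | hx)
    exacts [ha, hb, hi x hx]
  rcases h12 with h | h <;> rcases h0 with h0 | ⟨h0, -⟩ <;>
    exact key _ _ h h0 (by simp) (by simp only; omega) (by simp only; omega)

lemma exists_domSet_pendantStar {n m : ℕ} (hm : 5 ≤ m) (hmn : m ≤ n) :
    ∃ S : Set (Fin n), IsDomSet (pendantStar n m) S ∧ crOf (pendantStar n m) S = 1 ∧
      S.ncard = n - m + 2 := by
  set S : Set (Fin n) :=
    insert ⟨0, by omega⟩ (insert ⟨1, by omega⟩ {i : Fin n | m ≤ i.val}) with hSdef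
  have hS : ∀ i : Fin n, i ∈ S ↔ i.val = 0 ∨ i.val = 1 ∨ m ≤ i.val := by
    intro i
    simp [hSdef, Fin.ext_iff]
  have hdom : IsDomSet (pendantStar n m) S := by
    intro v
    by_cases hv : v ∈ S
    · exact ⟨v, hv, by simp [closedNbhd]⟩
    · rw [hS] at hv
      refine ⟨⟨0, by omega⟩, (hS _).2 (Or.inl rfl), ?_⟩
      simp [mem_closedNbhd_pendantStar]
      omega
  refine ⟨S, hdom, le_antisymm ?_ (hdom.one_le_crOf_pendantStar hm hmn), ?_⟩
  · rw [crOf, ← Set.ncard_singleton (⟨2, by omega⟩ : Fin n)]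
    refine Set.ncard_le_ncard ?_ (Set.toFinite _)
    intro x hx
    obtain ⟨a, ⟨hax, haS⟩, b, ⟨hbx, hbS⟩, hab⟩ := (Set.one_lt_ncard (Set.toFinite _)).1 hx
    rw [hS] at haS hbS
    rw [mem_closedNbhd_pendantStar] at hax hbx
    rw [Ne, Fin.ext_iff] at hab
    rw [Set.mem_singleton_iff, Fin.ext_iff]
    simp only
    omega
  · exact ncard_insert_insert_setOf_le_val _ _ (by simp) (by simp only; omega)
      (by simp only; omega)

lemma crNum_pendantStar {n m : ℕ} (hm : 5 ≤ m) (hmn : m ≤ n) :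
    crNum (pendantStar n m) = 1 := by
  obtain ⟨S, hS, hcr, -⟩ := exists_domSet_pendantStar hm hmn
  refine le_antisymm (Nat.sInf_le ⟨S, hS, hcr⟩) (le_csInf ⟨1, S, hS, hcr⟩ ?_)
  rintro k ⟨T, hT, rfl⟩
  exact hT.one_le_crOf_pendantStar hm hmn

lemma gammaCR_pendantStar {n m : ℕ} (hm : 5 ≤ m) (hmn : m ≤ n) :
    gammaCR (pendantStar n m) = n - m + 2 := by
  obtain ⟨S, hS, hcr, hcard⟩ := exists_domSet_pendantStar hm hmn
  rw [← crNum_pendantStar hm hmn] at hcr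
  refine le_antisymm (Nat.sInf_le ⟨S, hS, hcr, hcard⟩) (le_csInf ⟨_, S, hS, hcr, hcard⟩ ?_)
  rintro k ⟨T, hT, -, rfl⟩
  exact hT.le_ncard_pendantStar hm hmn

lemma ncard_edgeSet_pendantStar_le {n m : ℕ} (hm : 3 ≤ m) (hmn : m ≤ n) :
    (pendantStar n m).edgeSet.ncard ≤ m - 1 := by
  have hsub : (pendantStar n m).edgeSet ⊆
      ↑(insert s((⟨1, by omega⟩ : Fin n), ⟨2, by omega⟩)
        ((Finset.Ico 2 m).attach.image fun k =>
          s((⟨0, by omega⟩ : Fin n), ⟨k.1, (Finset.mem_Ico.1 k.2).2.trans_le hmn⟩))) := by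
    intro e
    induction e with | _ i j => ?_
    rw [SimpleGraph.mem_edgeSet, pendantStar, SimpleGraph.fromRel_adj]
    rintro ⟨-, (⟨h0, h⟩ | ⟨h1, h2⟩) | (⟨h0, h⟩ | ⟨h1, h2⟩)⟩
    · simp only [Finset.coe_insert, Finset.coe_image]
      exact Or.inr ⟨⟨j.val, Finset.mem_Ico.2 h⟩, by simp,
        Sym2.eq_iff.2 (Or.inl ⟨Fin.ext h0.symm, rfl⟩)⟩
    · simp only [Finset.coe_insert, Finset.coe_image]
      exact Or.inl (Sym2.eq_iff.2 (Or.inl ⟨Fin.ext h1, Fin.ext h2⟩))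
    · simp only [Finset.coe_insert, Finset.coe_image]
      exact Or.inr ⟨⟨i.val, Finset.mem_Ico.2 h⟩, by simp,
        Sym2.eq_iff.2 (Or.inr ⟨Fin.ext h0.symm, rfl⟩)⟩
    · simp only [Finset.coe_insert, Finset.coe_image]
      exact Or.inl (Sym2.eq_iff.2 (Or.inr ⟨Fin.ext h2, Fin.ext h1⟩))
  refine (Set.ncard_le_ncard hsub (Set.toFinite _)).trans ?_
  rw [Set.ncard_coe_finset]
  refine (Finset.card_insert_le _ _).trans ?_
  have := (Finset.card_image_le (s := (Finset.Ico 2 m).attach) (f := fun k =>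
    s((⟨0, by omega⟩ : Fin n), ⟨k.1, (Finset.mem_Ico.1 k.2).2.trans_le hmn⟩)))
  rw [Finset.card_attach, Nat.card_Ico] at this
  omega

theorem m_n_one_r (n r : ℕ) (hn : 5 ≤ n) (hr1 : 2 ≤ r) (hr2 : r ≤ n - 3) :
    (∀ (V : Type) [Fintype V] (G : SimpleGraph V), Fintype.card V = n →
        crNum G = 1 → gammaCR G = r →
        n - r + 1 ≤ G.edgeSet.ncard) ∧
    (∃ G : SimpleGraph (Fin n), crNum G = 1 ∧ gammaCR G = r ∧
        G.edgeSet.ncard = n - r + 1) := by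
  refine ⟨?_, pendantStar n (n - r + 2), ?_⟩
  · rintro V _ G rfl hcr rfl
    exact sub_gammaCR_lt_ncard_edgeSet G hcr
  · have hcr := crNum_pendantStar (n := n) (m := n - r + 2) (by omega) (by omega)
    have hγ := gammaCR_pendantStar (n := n) (m := n - r + 2) (by omega) (by omega)
    have hle := ncard_edgeSet_pendantStar_le (n := n) (m := n - r + 2) (by omega) (by omega)
    have hge := sub_gammaCR_lt_ncard_edgeSet _ hcr
    rw [Fintype.card_fin] at hge
    exact ⟨hcr, by omega, by omega⟩
end

section
/- Let n ≥ 5 be an integer and let m be an integer. (1) If 4 ≤ m ≤ n + 1, then the maximum of γ_CR(G) over all finite simple graphs G of order n with m edges and CR(G) = 1 equals n − 3. (2) If n + 2 ≤ m ≤ C(n−1, 2) and r is an integer with C(n−(r+1), 2) + (n − 2) < m ≤ C(n−r, 2) + (n − 2), then this maximum equals r. (3) If m > C(n−1, 2), then there is no finite simple graph G of order n with m edges and CR(G) = 1. -/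
open SimpleGraph Set

lemma mem_closedNbhd {V : Type*} {G : SimpleGraph V} {u v : V} :
    u ∈ closedNbhd G v ↔ u = v ∨ G.Adj v u := by
  simp [closedNbhd]

lemma isDomSet_iff {V : Type*} {G : SimpleGraph V} {S : Set V} :
    IsDomSet G S ↔ ∀ v, v ∈ S ∨ ∃ s ∈ S, G.Adj v s := by
  refine forall_congr' fun v => ?_
  simp only [mem_closedNbhd]
  constructor
  · rintro ⟨s, hs, rfl | h⟩
    · exact Or.inl hs
    · exact Or.inr ⟨s, hs, h.symm⟩
  · rintro (h | ⟨s, hs, h⟩)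
    · exact ⟨v, h, Or.inl rfl⟩
    · exact ⟨s, hs, Or.inr h.symm⟩

/-- The set of vertices overdominated by `S`. -/
def overSet {V : Type*} (G : SimpleGraph V) (S : Set V) : Set V :=
  {x : V | 2 ≤ (closedNbhd G x ∩ S).ncard}

lemma crOf_eq_ncard_overSet {V : Type*} (G : SimpleGraph V) (S : Set V) :
    crOf G S = (overSet G S).ncard := rfl

lemma mem_overSet {V : Type*} [Finite V] {G : SimpleGraph V} {S : Set V} {x : V} :
    x ∈ overSet G S ↔
      ∃ s ∈ S, ∃ t ∈ S, s ≠ t ∧ (s = x ∨ G.Adj x s) ∧ (t = x ∨ G.Adj x t) := by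
  have h : x ∈ overSet G S ↔ 1 < (closedNbhd G x ∩ S).ncard := Iff.rfl
  rw [h, Set.one_lt_ncard (Set.toFinite _)]
  simp only [Set.mem_inter_iff, mem_closedNbhd]
  constructor
  · rintro ⟨s, ⟨h1, h2⟩, t, ⟨h3, h4⟩, h5⟩
    exact ⟨s, h2, t, h4, h5, h1, h3⟩
  · rintro ⟨s, h2, t, h4, h5, h1, h3⟩
    exact ⟨s, ⟨h1, h2⟩, t, ⟨h3, h4⟩, h5⟩

lemma crOf_le_one {V : Type*} [Finite V] {G : SimpleGraph V} {S : Set V} {x : V}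
    (h : ∀ y ∈ overSet G S, y = x) : crOf G S ≤ 1 := by
  rw [crOf_eq_ncard_overSet, ← Set.ncard_singleton x]
  exact Set.ncard_le_ncard (fun y hy => h y hy) (Set.toFinite _)

lemma eq_of_crOf_le_one {V : Type*} [Finite V] {G : SimpleGraph V} {S : Set V}
    (h : crOf G S ≤ 1) {x y : V} (hx : x ∈ overSet G S) (hy : y ∈ overSet G S) : x = y :=
  (Set.ncard_le_one (Set.toFinite _)).1 h x hx y hy

lemma crOf_pos {V : Type*} [Finite V] {G : SimpleGraph V} {S : Set V} {x : V}
    (h : x ∈ overSet G S) : 1 ≤ crOf G S :=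
  (Set.ncard_pos (Set.toFinite _)).2 ⟨x, h⟩

lemma crNum_le {V : Type*} {G : SimpleGraph V} {S : Set V} (h : IsDomSet G S) :
    crNum G ≤ crOf G S :=
  Nat.sInf_le ⟨S, h, rfl⟩

lemma exists_crOf_eq_crNum {V : Type*} (G : SimpleGraph V) :
    ∃ S, IsDomSet G S ∧ crOf G S = crNum G :=
  Nat.sInf_mem (s := {k : ℕ | ∃ S : Set V, IsDomSet G S ∧ crOf G S = k})
    ⟨_, Set.univ, isDomSet_iff.2 fun _ => Or.inl trivial, rfl⟩

lemma exists_ncard_eq_gammaCR {V : Type*} (G : SimpleGraph V) :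
    ∃ S, IsDomSet G S ∧ crOf G S = crNum G ∧ S.ncard = gammaCR G := by
  obtain ⟨S, h1, h2⟩ := exists_crOf_eq_crNum G
  exact Nat.sInf_mem
    (s := {r : ℕ | ∃ S : Set V, IsDomSet G S ∧ crOf G S = crNum G ∧ S.ncard = r})
    ⟨_, S, h1, h2, rfl⟩

lemma gammaCR_le {V : Type*} {G : SimpleGraph V} {S : Set V} (hG : crNum G = 1)
    (h : IsDomSet G S) (h1 : crOf G S ≤ 1) : gammaCR G ≤ S.ncard :=
  Nat.sInf_le ⟨S, h, by have := crNum_le h; omega, rfl⟩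

/-- A bundled criterion for `crNum G = 1` and `gammaCR G = g`. -/
structure IsUnitCR {V : Type*} (G : SimpleGraph V) (g : ℕ) : Prop where
  exists_dom : ∃ S, IsDomSet G S ∧ crOf G S ≤ 1 ∧ S.ncard = g
  bound : ∀ S, IsDomSet G S → crOf G S ≤ 1 → 1 ≤ crOf G S ∧ g ≤ S.ncard

lemma IsUnitCR.crNum_eq {V : Type*} {G : SimpleGraph V} {g : ℕ} (h : IsUnitCR G g) :
    crNum G = 1 := by
  obtain ⟨S, h1, h2, h3⟩ := h.exists_dom
  obtain ⟨T, h4, h5⟩ := exists_crOf_eq_crNum G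
  have := crNum_le h1
  have := (h.bound T h4 (by omega)).1
  omega

lemma IsUnitCR.gammaCR_eq {V : Type*} {G : SimpleGraph V} {g : ℕ} (h : IsUnitCR G g) :
    gammaCR G = g := by
  obtain ⟨S, h1, h2, h3⟩ := h.exists_dom
  obtain ⟨T, h4, h5, h6⟩ := exists_ncard_eq_gammaCR G
  have := gammaCR_le h.crNum_eq h1 h2
  have := (h.bound T h4 (by rw [h5, h.crNum_eq])).2
  omega

lemma two_le_ncard_of_mem_overSet {V : Type*} [Finite V] {G : SimpleGraph V} {S : Set V} {x : V}
    (h : x ∈ overSet G S) : 2 ≤ S.ncard :=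
  le_trans h (Set.ncard_le_ncard Set.inter_subset_right (Set.toFinite _))

/-- The structure of a dominating set with exactly one overdominated vertex. -/
lemma exists_overdominated {V : Type*} [Finite V] {G : SimpleGraph V} {S : Set V}
    (hS : IsDomSet G S) (h1 : crOf G S = 1) :
    (∀ s ∈ S, ∀ t ∈ S, ¬ G.Adj s t) ∧
    ∃ x, x ∉ S ∧ (∀ y, y ∉ S → y ≠ x → ∃ s ∈ S, G.Adj y s ∧ ∀ t ∈ S, G.Adj y t → t = s) ∧
      ∃ a ∈ S, ∃ b ∈ S, a ≠ b ∧ G.Adj x a ∧ G.Adj x b := by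
  have hind : ∀ s ∈ S, ∀ t ∈ S, ¬ G.Adj s t := by
    intro s hs t ht hst
    apply hst.ne
    exact eq_of_crOf_le_one h1.le
      (mem_overSet.2 ⟨s, hs, t, ht, hst.ne, Or.inl rfl, Or.inr hst⟩)
      (mem_overSet.2 ⟨s, hs, t, ht, hst.ne, Or.inr hst.symm, Or.inl rfl⟩)
  refine ⟨hind, ?_⟩
  obtain ⟨x, hx⟩ : (overSet G S).Nonempty := by
    rw [← Set.ncard_pos (Set.toFinite _), ← crOf_eq_ncard_overSet]; omega
  obtain ⟨s, hs, t, ht, hne, hsx, htx⟩ := mem_overSet.1 hx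
  have hxS : x ∉ S := by
    intro hxS
    rcases hsx with rfl | hsx
    · rcases htx with rfl | htx
      · exact hne rfl
      · exact hind _ hxS _ ht htx
    · exact hind _ hxS _ hs hsx
  refine ⟨x, hxS, ?_, s, hs, t, ht, hne, ?_, ?_⟩
  · intro y hy hyx
    rcases isDomSet_iff.1 hS y with h | ⟨u, hu, hyu⟩
    · exact absurd h hy
    · refine ⟨u, hu, hyu, fun v hv hyv => ?_⟩
      by_contra hvu
      exact hyx (eq_of_crOf_le_one h1.le
        (mem_overSet.2 ⟨v, hv, u, hu, hvu, Or.inr hyv, Or.inr hyu⟩) hx)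
  · rcases hsx with rfl | h
    · exact absurd hs hxS
    · exact h
  · rcases htx with rfl | h
    · exact absurd ht hxS
    · exact h

lemma exists_not_adj_of_crNum_ne_zero {V : Type*} [Finite V] {G : SimpleGraph V}
    (h : crNum G ≠ 0) (x : V) : ∃ u, u ≠ x ∧ ¬ G.Adj x u := by
  by_contra! hc
  apply h
  have hd : IsDomSet G {x} := isDomSet_iff.2 fun v => by
    by_cases hv : v = x
    · exact Or.inl hv
    · exact Or.inr ⟨x, rfl, (hc v hv).symm⟩
  have h0 : overSet G {x} = ∅ := by
    ext y
    simp only [mem_overSet, Set.mem_singleton_iff, Set.mem_empty_iff_false, iff_false]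
    rintro ⟨s, rfl, t, rfl, hne, -⟩
    exact hne rfl
  have := crNum_le hd
  rw [crOf_eq_ncard_overSet, h0, Set.ncard_empty] at this
  omega

lemma ncard_edgeSet_add_one_le {V : Type*} [Fintype V] {G : SimpleGraph V} {S : Set V}
    (hG : crNum G = 1) (hS : IsDomSet G S) (h1 : crOf G S = 1) :
    G.edgeSet.ncard + 1 ≤ (Fintype.card V - S.ncard).choose 2 + (Fintype.card V - 1) := by
  classical
  obtain ⟨hind, x, hxS, huniq, -⟩ := exists_overdominated hS h1
  obtain ⟨u, hux, hxu⟩ := exists_not_adj_of_crNum_ne_zero (by omega : crNum G ≠ 0) x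
  have hex : ∀ y, ∃ s, y ∉ S → y ≠ x → s ∈ S ∧ G.Adj y s ∧ ∀ t ∈ S, G.Adj y t → t = s := by
    intro y
    by_cases h : y ∉ S ∧ y ≠ x
    · obtain ⟨s, h1, h2, h3⟩ := huniq y h.1 h.2
      exact ⟨s, fun _ _ => ⟨h1, h2, h3⟩⟩
    · exact ⟨y, fun a b => absurd ⟨a, b⟩ h⟩
  choose f hf using hex
  let A := S.toFinset
  let B := Sᶜ.toFinset
  have hA : A.card = S.ncard := (Set.ncard_eq_toFinset_card' S).symm
  have hB : B.card = Fintype.card V - S.ncard := by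
    rw [← Nat.card_eq_fintype_card, ← Set.ncard_compl, Set.ncard_eq_toFinset_card']
  let E1 := B.offDiag.image (fun p : V × V => s(p.1, p.2))
  let E2 := (B.erase x).image (fun y => s(y, f y))
  let E3 := A.image (fun s => s(x, s))
  have hxB : x ∈ B := by simpa [B] using hxS
  have hsub : insert s(x, u) G.edgeSet ⊆ ((E1 ∪ E2 ∪ E3 : Finset (Sym2 V)) : Set (Sym2 V)) := by
    have key : ∀ v w, v ∉ S → v ≠ w → (v = x ∨ G.Adj v w) → s(v, w) ∈ E1 ∪ E2 ∪ E3 := by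
      intro v w hv hvw h
      simp only [Finset.mem_union]
      by_cases hw : w ∈ S
      · by_cases hvx : v = x
        · subst hvx
          exact Or.inr (Finset.mem_image.2 ⟨w, by simpa [A] using hw, rfl⟩)
        · refine Or.inl (Or.inr (Finset.mem_image.2 ⟨v, by simpa [B] using ⟨hvx, hv⟩, ?_⟩))
          rw [(hf v hv hvx).2.2 w hw (h.resolve_left hvx)]
      · exact Or.inl (Or.inl (Finset.mem_image.2
          ⟨(v, w), by simpa [B] using ⟨hv, hw, hvw⟩, rfl⟩))
    intro e he
    rcases he with rfl | he
    · exact key x u hxS hux.symm (Or.inl rfl)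
    · induction e using Sym2.ind with
      | _ v w =>
        have hvw : G.Adj v w := he
        by_cases hv : v ∈ S
        · have hw : w ∉ S := fun hw => hind v hv w hw hvw
          rw [Sym2.eq_swap]
          exact key w v hw hvw.ne' (Or.inr hvw.symm)
        · exact key v w hv hvw.ne (Or.inr hvw)
  have hcard := Set.ncard_le_ncard hsub (Set.toFinite _)
  rw [Set.ncard_insert_of_notMem (by simpa using hxu) (Set.toFinite _),
    Set.ncard_coe_finset] at hcard
  have c1 : E1.card = B.card.choose 2 := Sym2.card_image_offDiag B
  have c2 : E2.card ≤ B.card - 1 := by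
    rw [← Finset.card_erase_of_mem hxB]; exact Finset.card_image_le
  have c3 : E3.card ≤ A.card := Finset.card_image_le
  have c4 := Finset.card_union_le (E1 ∪ E2) E3
  have c5 := Finset.card_union_le E1 E2
  have hpos : 0 < B.card := Finset.card_pos.2 ⟨x, hxB⟩
  rw [c1, hB] at c5
  omega

lemma choose_two_step (k : ℕ) : (k + 1).choose 2 = k + k.choose 2 := by
  rw [Nat.choose_succ_succ' k 1, Nat.choose_one_right]

/-- A graph of order `n` with `CR(G) = 1` satisfies `γ_CR(G) ≤ n - 3`. -/
lemma gammaCR_le_card_sub_three {V : Type*} [Fintype V] {G : SimpleGraph V}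
    (hG : crNum G = 1) : gammaCR G ≤ Fintype.card V - 3 := by
  classical
  obtain ⟨S, hS, h1, hcard⟩ := exists_ncard_eq_gammaCR G
  rw [hG] at h1
  obtain ⟨hind, x, hxS, huniq, a, ha, b, hb, hab, hxa, hxb⟩ := exists_overdominated hS h1
  by_contra! hlt
  have hcompl : Sᶜ.ncard + S.ncard = Fintype.card V := by
    rw [add_comm, Set.ncard_add_ncard_compl, Nat.card_eq_fintype_card]
  have hge : 1 < (S ∩ G.neighborSet x).ncard :=
    (Set.one_lt_ncard (Set.toFinite _)).2 ⟨a, ⟨ha, hxa⟩, b, ⟨hb, hxb⟩, hab⟩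
  have hsplit := Set.ncard_inter_add_ncard_sdiff_eq_ncard S (G.neighborSet x) (Set.toFinite _)
  let T : Set V := insert x (S \ G.neighborSet x)
  have hTcard : T.ncard ≤ (S \ G.neighborSet x).ncard + 1 := Set.ncard_insert_le _ _
  have hTlt : T.ncard < S.ncard := by omega
  have hTcase : ∀ y, (∀ v, v ∉ S → v = x ∨ v = y) →
      (y ∉ S → y ≠ x → ¬ G.Adj x y → ∃ z ∈ S, G.Adj y z ∧ ¬ G.Adj x z) → False := by
    intro y hy hyT
    have hTdom : IsDomSet G T := by
      refine isDomSet_iff.2 fun v => ?_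
      by_cases hvx : v = x
      · exact Or.inl (Or.inl hvx)
      by_cases hxv : G.Adj x v
      · exact Or.inr ⟨x, Or.inl rfl, hxv.symm⟩
      by_cases hvS : v ∈ S
      · exact Or.inl (Or.inr ⟨hvS, hxv⟩)
      · obtain rfl := (hy v hvS).resolve_left hvx
        obtain ⟨z, hz, hvz, hxz⟩ := hyT hvS hvx hxv
        exact Or.inr ⟨z, Or.inr ⟨hz, hxz⟩, hvz⟩
    have hTover : ∀ v ∈ overSet G T, v = y := by
      intro v hv
      obtain ⟨s, hs, t, ht, hst, hsv, htv⟩ := mem_overSet.1 hv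
      by_contra hvy
      have hsame : ∀ p ∈ T, (p = v ∨ G.Adj v p) → (v ∈ T → p = v) ∧ (v ∉ T → p = x) := by
        intro p hp hpv
        rcases hp with rfl | ⟨hpS, hpx⟩
        · refine ⟨fun hvT => ?_, fun _ => rfl⟩
          rcases hpv with rfl | hpv
          · rfl
          · rcases hvT with rfl | ⟨_, hh⟩
            · rfl
            · exact absurd hpv.symm hh
        · rcases hpv with rfl | hpv
          · exact ⟨fun _ => rfl, fun h => absurd (Or.inr ⟨hpS, hpx⟩) h⟩
          · exfalso
            by_cases hvS : v ∈ S
            · exact hind v hvS p hpS hpv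
            · obtain rfl := (hy v hvS).resolve_right hvy
              exact hpx hpv
      by_cases hvT : v ∈ T
      · exact hst (((hsame s hs hsv).1 hvT).trans ((hsame t ht htv).1 hvT).symm)
      · exact hst (((hsame s hs hsv).2 hvT).trans ((hsame t ht htv).2 hvT).symm)
    have := gammaCR_le hG hTdom (crOf_le_one hTover)
    omega
  by_cases hone : ∀ v, v ∉ S → v = x
  · exact hTcase x (fun v hv => Or.inl (hone v hv)) (fun _ h => absurd rfl h)
  push Not at hone
  obtain ⟨y, hyS, hyx⟩ := hone
  have hy : ∀ v, v ∉ S → v = x ∨ v = y := by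
    intro v hv
    by_contra! hc
    have h3 : 2 < Sᶜ.ncard := (Set.two_lt_ncard (Set.toFinite _)).2
      ⟨x, hxS, y, hyS, v, hv, hyx.symm, hc.1.symm, hc.2.symm⟩
    omega
  by_cases hyT : y ∉ S → y ≠ x → ¬ G.Adj x y → ∃ z ∈ S, G.Adj y z ∧ ¬ G.Adj x z
  · exact hTcase y hy hyT
  push Not at hyT
  obtain ⟨-, -, hxy, hall⟩ := hyT
  obtain ⟨z, hz, hyz, hzuniq⟩ := huniq y hyS hyx
  have hxz : G.Adj x z := hall z hz hyz
  have hNy : ∀ v, G.Adj y v → v = z := by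
    intro v hv
    by_cases hvS : v ∈ S
    · exact hzuniq v hvS hv
    · rcases hy v hvS with rfl | rfl
      · exact absurd hv.symm hxy
      · exact absurd rfl hv.ne
  by_cases hthree : 2 < (S ∩ G.neighborSet x).ncard
  · let U : Set V := insert y T
    have hUcard : U.ncard ≤ T.ncard + 1 := Set.ncard_insert_le _ _
    have hUdom : IsDomSet G U := by
      refine isDomSet_iff.2 fun v => ?_
      by_cases hvx : v = x
      · exact Or.inl (Or.inr (Or.inl hvx))
      by_cases hvy : v = y
      · exact Or.inl (Or.inl hvy)
      have hvS : v ∈ S := by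
        by_contra h
        exact (hy v h).elim hvx hvy
      by_cases hxv : G.Adj x v
      · exact Or.inr ⟨x, Or.inr (Or.inl rfl), hxv.symm⟩
      · exact Or.inl (Or.inr (Or.inr ⟨hvS, hxv⟩))
    have hUover : ∀ v ∈ overSet G U, v = z := by
      intro v hv
      obtain ⟨s, hs, t, ht, hst, hsv, htv⟩ := mem_overSet.1 hv
      by_contra hvz
      have hsame : ∀ p ∈ U, (p = v ∨ G.Adj v p) → (v ∈ U → p = v) ∧ (v ∉ U → p = x) := by
        intro p hp hpv
        rcases hp with rfl | rfl | ⟨hpS, hpx⟩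
        · rcases hpv with rfl | hpv
          · exact ⟨fun _ => rfl, fun h => absurd (Or.inl rfl) h⟩
          · exact absurd (hNy v hpv.symm) hvz
        · refine ⟨fun hvU => ?_, fun _ => rfl⟩
          rcases hpv with rfl | hpv
          · rfl
          · rcases hvU with rfl | rfl | ⟨_, hh⟩
            · exact absurd hpv.symm hxy
            · rfl
            · exact absurd hpv.symm hh
        · rcases hpv with rfl | hpv
          · exact ⟨fun _ => rfl, fun h => absurd (Or.inr (Or.inr ⟨hpS, hpx⟩)) h⟩
          · exfalso
            by_cases hvS : v ∈ S
            · exact hind v hvS p hpS hpv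
            · rcases hy v hvS with rfl | rfl
              · exact hpx hpv
              · rw [hNy p hpv] at hpx
                exact hpx hxz
      by_cases hvU : v ∈ U
      · exact hst (((hsame s hs hsv).1 hvU).trans ((hsame t ht htv).1 hvU).symm)
      · exact hst (((hsame s hs hsv).2 hvU).trans ((hsame t ht htv).2 hvU).symm)
    have := gammaCR_le hG hUdom (crOf_le_one hUover)
    omega
  · have hpair : ∀ v ∈ S, G.Adj x v → ∀ w ∈ S, G.Adj x w → v ≠ z → w ≠ z → v = w := by
      intro v hv hxv w hw hxw hvz hwz
      by_contra hvw
      exact hthree ((Set.two_lt_ncard (Set.toFinite _)).2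
        ⟨v, ⟨hv, hxv⟩, w, ⟨hw, hxw⟩, z, ⟨hz, hxz⟩, hvw, hvz, hwz⟩)
    obtain ⟨c, hc, hxc, hcz⟩ : ∃ c ∈ S, G.Adj x c ∧ c ≠ z := by
      by_cases haz : a = z
      · exact ⟨b, hb, hxb, fun h => hab (haz.trans h.symm)⟩
      · exact ⟨a, ha, hxa, haz⟩
    let U : Set V := insert y (S \ {z})
    have hUdom : IsDomSet G U := by
      refine isDomSet_iff.2 fun v => ?_
      by_cases hvx : v = x
      · subst hvx
        exact Or.inr ⟨c, Or.inr ⟨hc, hcz⟩, hxc⟩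
      by_cases hvy : v = y
      · exact Or.inl (Or.inl hvy)
      have hvS : v ∈ S := by
        by_contra h
        exact (hy v h).elim hvx hvy
      by_cases hvz : v = z
      · subst hvz
        exact Or.inr ⟨y, Or.inl rfl, hyz.symm⟩
      · exact Or.inl (Or.inr ⟨hvS, hvz⟩)
    have hUover : overSet G U = ∅ := by
      refine Set.eq_empty_iff_forall_notMem.2 fun v hv => ?_
      obtain ⟨s, hs, t, ht, hst, hsv, htv⟩ := mem_overSet.1 hv
      have hsame : ∀ p ∈ U, (p = v ∨ G.Adj v p) →
          (v ∈ U → p = v) ∧ (v = x → p = c) ∧ (v = z → p = y) := by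
        intro p hp hpv
        rcases hp with rfl | ⟨hpS, hpz⟩
        · rcases hpv with rfl | hpv
          · exact ⟨fun _ => rfl, fun h => absurd h hyx, fun _ => rfl⟩
          · obtain rfl := hNy v hpv.symm
            refine ⟨?_, fun h => absurd (h ▸ hz) hxS, fun _ => rfl⟩
            rintro (h | ⟨_, h⟩)
            · exact h.symm
            · exact absurd rfl h
        · rcases hpv with rfl | hpv
          · exact ⟨fun _ => rfl, fun h => absurd (h ▸ hpS) hxS, fun h => absurd h hpz⟩
          · have hvS : v ∉ S := fun hvS => hind v hvS p hpS hpv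
            have hvy : v ≠ y := by
              rintro rfl
              exact hpz (hNy p hpv)
            obtain rfl := (hy v hvS).resolve_right hvy
            refine ⟨?_, fun _ => hpair p hpS hpv c hc hxc hpz hcz, fun h => absurd (h ▸ hz) hxS⟩
            rintro (h | ⟨h, _⟩)
            · exact absurd h hvy
            · exact absurd h hvS
      have hs' := hsame s hs hsv
      have ht' := hsame t ht htv
      by_cases hvU : v ∈ U
      · exact hst ((hs'.1 hvU).trans (ht'.1 hvU).symm)
      by_cases hvx : v = x
      · exact hst ((hs'.2.1 hvx).trans (ht'.2.1 hvx).symm)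
      by_cases hvz : v = z
      · exact hst ((hs'.2.2 hvz).trans (ht'.2.2 hvz).symm)
      by_cases hvS : v ∈ S
      · exact hvU (Or.inr ⟨hvS, hvz⟩)
      · rcases hy v hvS with h | rfl
        · exact hvx h
        · exact hvU (Or.inl rfl)
    have := crNum_le hUdom
    rw [crOf_eq_ncard_overSet, hUover, Set.ncard_empty] at this
    omega

/-- Adding isolated vertices raises the minimum cardinality by the number of added vertices. -/
lemma IsUnitCR.map {V W : Type*} [Fintype V] [Fintype W] {G : SimpleGraph W} {g : ℕ}
    (h : IsUnitCR G g) (e : W ↪ V) :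
    IsUnitCR (G.map e) (g + (Fintype.card V - Fintype.card W)) := by
  have hover : ∀ S : Set V, crOf (G.map e) S = crOf G (e ⁻¹' S) := by
    intro S
    have : overSet (G.map e) S = e '' overSet G (e ⁻¹' S) := by
      ext v
      simp only [mem_overSet, Set.mem_image, SimpleGraph.map_adj]
      constructor
      · rintro ⟨s, hs, t, ht, hst, h1, h2⟩
        rcases h1 with rfl | ⟨a, b, hab, rfl, rfl⟩
        · rcases h2 with rfl | ⟨c, d, hcd, rfl, rfl⟩
          · exact absurd rfl hst
          · exact ⟨c, ⟨c, hs, d, ht, hcd.ne, Or.inl rfl, Or.inr hcd⟩, rfl⟩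
        · rcases h2 with rfl | ⟨c, d, hcd, hc, rfl⟩
          · exact ⟨a, ⟨b, hs, a, ht, hab.ne', Or.inr hab, Or.inl rfl⟩, rfl⟩
          · obtain rfl := e.injective hc
            exact ⟨c, ⟨b, hs, d, ht, fun h => hst (h ▸ rfl), Or.inr hab, Or.inr hcd⟩, rfl⟩
      · rintro ⟨w, ⟨s, hs, t, ht, hst, h1, h2⟩, rfl⟩
        exact ⟨e s, hs, e t, ht, fun h => hst (e.injective h),
          h1.imp (congrArg e) (fun h => ⟨_, _, h, rfl, rfl⟩),
          h2.imp (congrArg e) (fun h => ⟨_, _, h, rfl, rfl⟩)⟩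
    rw [crOf_eq_ncard_overSet, this, Set.ncard_image_of_injective _ e.injective,
      crOf_eq_ncard_overSet]
  have hdom : ∀ S : Set V,
      IsDomSet (G.map e) S ↔ IsDomSet G (e ⁻¹' S) ∧ (Set.range e)ᶜ ⊆ S := by
    intro S
    simp only [isDomSet_iff, SimpleGraph.map_adj]
    constructor
    · refine fun hS => ⟨fun w => ?_, fun v hv => ?_⟩
      · rcases hS (e w) with h | ⟨s, hs, a, b, hab, ha, rfl⟩
        · exact Or.inl h
        · obtain rfl := e.injective ha
          exact Or.inr ⟨b, hs, hab⟩
      · rcases hS v with h | ⟨s, hs, a, b, hab, rfl, rfl⟩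
        · exact h
        · exact absurd ⟨a, rfl⟩ hv
    · rintro ⟨h1, h2⟩ v
      by_cases hv : v ∈ Set.range e
      · obtain ⟨w, rfl⟩ := hv
        rcases h1 w with h | ⟨s, hs, hws⟩
        · exact Or.inl h
        · exact Or.inr ⟨e s, hs, w, s, hws, rfl, rfl⟩
      · exact Or.inl (h2 hv)
  have hcard : ∀ S : Set V, (Set.range e)ᶜ ⊆ S →
      S.ncard = (e ⁻¹' S).ncard + (Fintype.card V - Fintype.card W) := by
    intro S hS
    have h1 : S = e '' (e ⁻¹' S) ∪ (Set.range e)ᶜ := by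
      ext v
      rw [Set.image_preimage_eq_inter_range]
      by_cases hv : v ∈ Set.range e
      · simp [hv]
      · simp [hS hv, hv]
    have h2 : Disjoint (e '' (e ⁻¹' S)) (Set.range e)ᶜ :=
      Set.disjoint_compl_right_iff_subset.2 (Set.image_subset_range _ _)
    have h3 : (Set.range e).ncard = Fintype.card W := by
      rw [← Set.image_univ, Set.ncard_image_of_injective _ e.injective, Set.ncard_univ,
        Nat.card_eq_fintype_card]
    conv_lhs => rw [h1]
    rw [Set.ncard_union_eq h2 (Set.toFinite _) (Set.toFinite _),
      Set.ncard_image_of_injective _ e.injective, Set.ncard_compl, h3, Nat.card_eq_fintype_card]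
  refine ⟨?_, fun S hS h1 => ?_⟩
  · obtain ⟨S, h1, h2, h3⟩ := h.exists_dom
    have hpre : e ⁻¹' (e '' S ∪ (Set.range e)ᶜ) = S := by
      ext w
      simp
    refine ⟨e '' S ∪ (Set.range e)ᶜ, (hdom _).2 ⟨by rwa [hpre], Set.subset_union_right⟩, ?_, ?_⟩
    · rwa [hover, hpre]
    · rw [hcard _ Set.subset_union_right, hpre, h3]
  · obtain ⟨h2, h3⟩ := (hdom S).1 hS
    rw [hover] at h1 ⊢
    obtain ⟨h4, h5⟩ := h.bound _ h2 h1
    rw [hcard S h3]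
    exact ⟨h4, by omega⟩

lemma exists_fin_of_isUnitCR {W : Type*} [Fintype W] {G : SimpleGraph W} {g : ℕ}
    (h : IsUnitCR G g) {n : ℕ} (hn : Fintype.card W ≤ n) :
    ∃ H : SimpleGraph (Fin n), H.edgeSet.ncard = G.edgeSet.ncard ∧ crNum H = 1 ∧
      gammaCR H = g + (n - Fintype.card W) := by
  obtain ⟨e⟩ : Nonempty (W ↪ Fin n) :=
    Function.Embedding.nonempty_of_card_le (by simpa using hn)
  have h1 := h.map e
  refine ⟨G.map e, ?_, h1.crNum_eq, ?_⟩
  · rw [SimpleGraph.edgeSet_map, Set.ncard_image_of_injective _ e.sym2Map.injective]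
  · rw [h1.gammaCR_eq, Fintype.card_fin]

lemma ncard_edgeSet_deleteEdges_add {V : Type*} [Finite V] {G : SimpleGraph V} {k j : ℕ}
    (hj : j ≤ k) {d : Fin k → Sym2 V} (hd : Function.Injective d) (hG : ∀ i, d i ∈ G.edgeSet) :
    (G.deleteEdges (d '' {i | i.val < j})).edgeSet.ncard + j = G.edgeSet.ncard := by
  have h1 : (d '' {i | i.val < j}).ncard = j := by
    rw [Set.ncard_image_of_injective _ hd]
    have : {i : Fin k | i.val < j} = Set.range (Fin.castLE hj) := by
      ext i; simp
    rw [this, ← Set.image_univ, Set.ncard_image_of_injective _ (Fin.castLE_injective hj),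
      Set.ncard_univ, Nat.card_eq_fintype_card, Fintype.card_fin]
  have h2 : d '' {i | i.val < j} ⊆ G.edgeSet := by
    rintro _ ⟨i, -, rfl⟩
    exact hG i
  have h3 := Set.ncard_sdiff_add_ncard_of_subset h2 (Set.toFinite _)
  rw [h1] at h3
  rw [SimpleGraph.edgeSet_deleteEdges, h3]

lemma ncard_range_inl {α β : Type*} [Fintype α] :
    (Set.range (Sum.inl : α → α ⊕ β)).ncard = Fintype.card α := by
  rw [← Set.image_univ, Set.ncard_image_of_injective _ Sum.inl_injective, Set.ncard_univ,
    Nat.card_eq_fintype_card]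

/-- A complete graph on `Option (Fin k)`, together with `r` independent vertices, all joined to
the hub `none`; every other vertex `i` of the complete graph is joined to the independent
vertex `f i`. -/
def hubGraph {r k : ℕ} (f : Fin k → Fin r) : SimpleGraph (Fin r ⊕ Option (Fin k)) :=
  SimpleGraph.fromRel fun u v => match u, v with
    | .inr _, .inr _ => True
    | .inr none, .inl _ => True
    | .inr (some i), .inl s => f i = s
    | _, _ => False

section hubGraph

variable {r k : ℕ} (f : Fin k → Fin r)

@[simp] lemma hubGraph_inr_inr (u v : Option (Fin k)) :
    (hubGraph f).Adj (.inr u) (.inr v) ↔ u ≠ v := by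
  simp [hubGraph]

@[simp] lemma hubGraph_inl_inl (s t : Fin r) : ¬ (hubGraph f).Adj (.inl s) (.inl t) := by
  simp [hubGraph]

@[simp] lemma hubGraph_hub_inl (s : Fin r) : (hubGraph f).Adj (.inr none) (.inl s) := by
  simp [hubGraph]

@[simp] lemma hubGraph_inl_hub (s : Fin r) : (hubGraph f).Adj (.inl s) (.inr none) := by
  simp [hubGraph]

@[simp] lemma hubGraph_some_inl (i : Fin k) (s : Fin r) :
    (hubGraph f).Adj (.inr (some i)) (.inl s) ↔ f i = s := by
  simp [hubGraph]

@[simp] lemma hubGraph_inl_some (i : Fin k) (s : Fin r) :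
    (hubGraph f).Adj (.inl s) (.inr (some i)) ↔ f i = s := by
  simp [hubGraph]

lemma ncard_edgeSet_hubGraph :
    (hubGraph f).edgeSet.ncard = (k + 1).choose 2 + k + r := by
  classical
  let E1 : Finset (Sym2 (Fin r ⊕ Option (Fin k))) :=
    ((Finset.univ.map ⟨Sum.inr, Sum.inr_injective⟩ :
      Finset (Fin r ⊕ Option (Fin k))).offDiag).image (fun p => s(p.1, p.2))
  let E2 : Finset (Sym2 (Fin r ⊕ Option (Fin k))) :=
    Finset.univ.image fun i : Fin k => s(.inr (some i), .inl (f i))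
  let E3 : Finset (Sym2 (Fin r ⊕ Option (Fin k))) :=
    Finset.univ.image fun s : Fin r => s(.inr none, .inl s)
  have hE1 : ∀ a b, s(.inr a, .inr b) ∈ E1 ↔ a ≠ b := by
    intro a b
    simp only [E1, Finset.mem_image]
    constructor
    · rintro ⟨⟨u, v⟩, h, h2⟩ rfl
      rcases Sym2.eq_iff.1 h2 with ⟨h3, h4⟩ | ⟨h3, h4⟩ <;> simp_all
    · exact fun h => ⟨(.inr a, .inr b), by simpa using h, rfl⟩
  have hE1l : ∀ a v, s(.inl a, v) ∉ E1 := by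
    intro a v
    simp [E1]
  have hE1r : ∀ a v, s(v, .inl a) ∉ E1 := by
    intro a v
    simp [E1]
  have hE : (hubGraph f).edgeSet = ((E1 ∪ E2 ∪ E3 : Finset _) : Set _) := by
    ext e
    induction e using Sym2.ind with
    | _ u v => rcases u with s | _ | i <;> rcases v with t | _ | j <;>
      simp [hE1, hE1l, hE1r, E2, E3]
  have d1 : Disjoint E1 E2 := by
    simp only [E1, E2, Finset.disjoint_left, Finset.mem_image]
    rintro _ ⟨⟨u, v⟩, h, rfl⟩ ⟨i, -, h2⟩
    rcases u with s | u <;> rcases v with t | v <;> simp at h h2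
  have d2 : Disjoint (E1 ∪ E2) E3 := by
    simp only [E1, E2, E3, Finset.disjoint_left, Finset.mem_image, Finset.mem_union]
    rintro _ (⟨⟨u, v⟩, h, rfl⟩ | ⟨i, -, rfl⟩) ⟨i, -, h2⟩
    · rcases u with s | u <;> rcases v with t | v <;> simp at h h2
    · simp at h2
  rw [hE, Set.ncard_coe_finset, Finset.card_union_of_disjoint d2,
    Finset.card_union_of_disjoint d1]
  have c1 : E1.card = (k + 1).choose 2 := by
    refine (Sym2.card_image_offDiag _).trans ?_
    simp
  have c2 : E2.card = k := by
    refine (Finset.card_image_of_injective _ fun i j h => ?_).trans (by simp)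
    simp at h
    exact h.1
  have c3 : E3.card = r := by
    refine (Finset.card_image_of_injective _ fun i j h => ?_).trans (by simp)
    simpa using h
  rw [c1, c2, c3]

lemma eq_hub_of_mem_overSet {G : SimpleGraph (Fin r ⊕ Option (Fin k))} (hG : G ≤ hubGraph f)
    {v : Fin r ⊕ Option (Fin k)} (hv : v ∈ overSet G (Set.range Sum.inl)) : v = .inr none := by
  obtain ⟨_, ⟨s, rfl⟩, _, ⟨t, rfl⟩, hst, hs, ht⟩ := mem_overSet.1 hv
  have hs' := hs.imp id (fun h => hG h)
  have ht' := ht.imp id (fun h => hG h)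
  rcases v with a | _ | i
  · simp at hs' ht'
    simp_all
  · rfl
  · simp at hs' ht'
    simp_all

lemma isDomSet_range_inl {G : SimpleGraph (Fin r ⊕ Option (Fin k))} {s : Fin r}
    (h1 : G.Adj (.inr none) (.inl s)) (h2 : ∀ i, G.Adj (.inr (some i)) (.inl (f i))) :
    IsDomSet G (Set.range Sum.inl) := by
  refine isDomSet_iff.2 fun v => ?_
  rcases v with a | _ | i
  · exact Or.inl ⟨a, rfl⟩
  · exact Or.inr ⟨_, ⟨s, rfl⟩, h1⟩
  · exact Or.inr ⟨_, ⟨f i, rfl⟩, h2 i⟩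

end hubGraph

lemma exists_isUnitCR_of_three_le {r k j : ℕ} (hr : 3 ≤ r) (hk : 2 ≤ k) (hj : 1 ≤ j)
    (hjk : j ≤ k) : ∃ G : SimpleGraph (Fin r ⊕ Option (Fin k)),
      G.edgeSet.ncard + j = (k + 1).choose 2 + k + r ∧ IsUnitCR G r := by
  obtain ⟨r, rfl⟩ := Nat.exists_eq_add_of_le' hr
  obtain ⟨k, rfl⟩ := Nat.exists_eq_add_of_le' hk
  let f : Fin (k + 2) → Fin (r + 3) := fun _ => 0
  let d : Fin (k + 2) → Sym2 (Fin (r + 3) ⊕ Option (Fin (k + 2))) := fun i =>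
    if i = 0 then s(.inr none, .inl 0) else s(.inr (some 0), .inr (some i))
  have hd : Function.Injective d := by
    intro a b h
    simp only [d] at h
    split_ifs at h with ha hb hb
    · rw [ha, hb]
    · simp at h
    · simp at h
    · simp at h
      grind
  have hdG : ∀ i, d i ∈ (hubGraph f).edgeSet := by
    intro i
    simp only [d]
    split_ifs with hi
    · simp
    · simpa using Ne.symm hi
  let G := (hubGraph f).deleteEdges (d '' {i | i.val < j})
  have hle : G ≤ hubGraph f := SimpleGraph.deleteEdges_le _
  have hadj : ∀ u v, G.Adj u v ↔ (hubGraph f).Adj u v ∧ ∀ i : Fin (k + 2), i.val < j →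
      d i ≠ s(u, v) := by
    intro u v
    simp [G, SimpleGraph.deleteEdges_adj]
  have hx0 : ¬ G.Adj (.inr none) (.inl 0) := by
    rw [hadj]
    exact fun h => h.2 0 hj (by simp [d])
  have hxs : ∀ s, s ≠ 0 → G.Adj (.inr none) (.inl s) := by
    intro s hs
    refine (hadj _ _).2 ⟨by simp, fun i _ => ?_⟩
    simp only [d]
    split_ifs <;> simp [Ne.symm hs]
  have hxi : ∀ i, G.Adj (.inr none) (.inr (some i)) := by
    intro i
    refine (hadj _ _).2 ⟨by simp, fun i _ => ?_⟩
    simp only [d]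
    split_ifs <;> simp
  have h0i : ∀ i, G.Adj (.inr (some i)) (.inl 0) := by
    intro i
    refine (hadj _ _).2 ⟨by simp [f], fun i _ => ?_⟩
    simp only [d]
    split_ifs <;> simp
  have hsi : ∀ s v, s ≠ 0 → G.Adj (.inl s) v → v = .inr none := by
    intro s v hs h
    have := hle h
    rcases v with t | _ | i
    · simp at this
    · rfl
    · simp [f] at this
      exact absurd this.symm hs
  refine ⟨G, ?_, ⟨Set.range Sum.inl, isDomSet_range_inl f (hxs 1 (by simp)) h0i,
    crOf_le_one fun v hv => eq_hub_of_mem_overSet f hle hv, by simp [ncard_range_inl]⟩, ?_⟩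
  · rw [ncard_edgeSet_deleteEdges_add hjk hd hdG, ncard_edgeSet_hubGraph]
  intro S hS h1
  rw [isDomSet_iff] at hS
  obtain ⟨t, htS, ht⟩ : ∃ t ∈ S, t = .inl 0 ∨ ∃ i, t = .inr (some i) := by
    rcases hS (.inl 0) with h | ⟨v, hv, hadjv⟩
    · exact ⟨_, h, Or.inl rfl⟩
    · refine ⟨v, hv, Or.inr ?_⟩
      rcases v with s | _ | i
      · simpa using hle hadjv
      · exact absurd hadjv.symm hx0
      · exact ⟨i, rfl⟩
  have hxS : Sum.inr none ∉ S := by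
    intro hx
    rcases ht with rfl | ⟨i, rfl⟩
    · have key : ∀ i, Sum.inr (some i) ∈ overSet G S := fun i => mem_overSet.2
        ⟨_, hx, _, htS, by simp, Or.inr (hxi i).symm, Or.inr (h0i i)⟩
      have := eq_of_crOf_le_one h1 (key 0) (key 1)
      simp at this
    · have := eq_of_crOf_le_one h1
        (mem_overSet.2 ⟨_, hx, _, htS, by simp, Or.inl rfl, Or.inr (hxi i)⟩)
        (mem_overSet.2 ⟨_, hx, _, htS, by simp, Or.inr (hxi i).symm, Or.inl rfl⟩)
      simp at this
  have hleaf : ∀ s, s ≠ 0 → Sum.inl s ∈ S := by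
    intro s hs
    rcases hS (.inl s) with h | ⟨v, hv, hsv⟩
    · exact h
    · exact absurd (hsi s v hs hsv ▸ hv) hxS
  have hlast : (Fin.last (r + 2)) ≠ 0 ∧ (1 : Fin (r + 3)) ≠ Fin.last (r + 2) := by
    simp [Fin.ext_iff]
  refine ⟨crOf_pos (x := Sum.inr none) (mem_overSet.2 ⟨.inl 1, hleaf 1 (by simp),
    .inl (Fin.last (r + 2)), hleaf _ hlast.1, fun h => hlast.2 (Sum.inl_injective h),
    Or.inr (hxs 1 (by simp)), Or.inr (hxs _ hlast.1)⟩), ?_⟩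
  have hsub : insert t (Sum.inl '' {s : Fin (r + 3) | s ≠ 0}) ⊆ S := by
    rintro _ (rfl | ⟨s, hs, rfl⟩)
    · exact htS
    · exact hleaf s hs
  have htn : t ∉ (Sum.inl '' {s : Fin (r + 3) | s ≠ 0} :
      Set (Fin (r + 3) ⊕ Option (Fin (k + 2)))) := by
    rcases ht with rfl | ⟨i, rfl⟩ <;> simp
  have h2 := Set.ncard_le_ncard hsub (Set.toFinite _)
  have h3 : {s : Fin (r + 3) | s ≠ 0}.ncard = r + 2 := by
    have : {s : Fin (r + 3) | s ≠ 0} = {0}ᶜ := rfl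
    rw [this, Set.ncard_compl, Set.ncard_singleton, Nat.card_eq_fintype_card, Fintype.card_fin]
    rfl
  rw [Set.ncard_insert_of_notMem htn (Set.toFinite _),
    Set.ncard_image_of_injective _ Sum.inl_injective, h3] at h2
  exact h2

lemma exists_isUnitCR_two {k j : ℕ} (hk : 2 ≤ k) (hj : 1 ≤ j) (hjk : j ≤ k) :
    ∃ G : SimpleGraph (Fin 2 ⊕ Option (Fin k)),
      G.edgeSet.ncard + j = (k + 1).choose 2 + k + 2 ∧ IsUnitCR G 2 := by
  obtain ⟨k, rfl⟩ := Nat.exists_eq_add_of_le' hk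
  let f : Fin (k + 2) → Fin 2 := fun i => if i = 0 then 1 else 0
  have hf0 : f 0 = 1 := rfl
  have hf1 : f 1 = 0 := by simp [f]
  have hfs : ∀ s, ∃ i, f i = s := by
    intro s
    fin_cases s
    · exact ⟨1, hf1⟩
    · exact ⟨0, hf0⟩
  let d : Fin (k + 2) → Sym2 (Fin 2 ⊕ Option (Fin (k + 2))) := fun i =>
    s(.inr none, .inr (some i))
  have hd : Function.Injective d := by
    intro a b h
    simpa [d] using h
  have hdG : ∀ i, d i ∈ (hubGraph f).edgeSet := by
    intro i
    simp [d]
  let G := (hubGraph f).deleteEdges (d '' {i | i.val < j})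
  have hle : G ≤ hubGraph f := SimpleGraph.deleteEdges_le _
  have hadj : ∀ u v, G.Adj u v ↔ (hubGraph f).Adj u v ∧ ∀ i : Fin (k + 2), i.val < j →
      d i ≠ s(u, v) := by
    intro u v
    simp [G, SimpleGraph.deleteEdges_adj]
  have hx0 : ¬ G.Adj (.inr none) (.inr (some 0)) := by
    rw [hadj]
    exact fun h => h.2 0 hj (by simp [d])
  have hxs : ∀ s, G.Adj (.inr none) (.inl s) := by
    intro s
    exact (hadj _ _).2 ⟨by simp, fun i _ => by simp [d]⟩
  have hsi : ∀ i, G.Adj (.inr (some i)) (.inl (f i)) := by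
    intro i
    exact (hadj _ _).2 ⟨by simp, fun i _ => by simp [d]⟩
  have hii : ∀ i i', i = i' ∨ G.Adj (.inr (some i)) (.inr (some i')) := by
    intro i i'
    by_cases h : i = i'
    · exact Or.inl h
    · exact Or.inr ((hadj _ _).2 ⟨by simpa using h, fun i _ => by simp [d]⟩)
  refine ⟨G, ?_, ⟨Set.range Sum.inl, isDomSet_range_inl f (hxs 1) hsi,
    crOf_le_one fun v hv => eq_hub_of_mem_overSet f hle hv, by simp [ncard_range_inl]⟩, ?_⟩
  · rw [ncard_edgeSet_deleteEdges_add hjk hd hdG, ncard_edgeSet_hubGraph]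
  intro S hS _
  suffices h : ∃ v, v ∈ overSet G S by
    obtain ⟨v, hv⟩ := h
    exact ⟨crOf_pos hv, two_le_ncard_of_mem_overSet hv⟩
  rw [isDomSet_iff] at hS
  have core : ∀ i i', i ≠ i' → Sum.inr (some i) ∈ S → Sum.inr (some i') ∈ S →
      ∃ v, v ∈ overSet G S := fun i i' h h1 h2 =>
    ⟨_, mem_overSet.2 ⟨_, h1, _, h2, by simpa using h, Or.inl rfl,
      Or.inr ((hii i i').resolve_left h)⟩⟩
  have mixed : ∀ s i, f i ≠ s → Sum.inl s ∈ S → Sum.inr (some i) ∈ S →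
      ∃ v, v ∈ overSet G S := by
    intro s i h h1 h2
    obtain ⟨i', rfl⟩ := hfs s
    have hne : i' ≠ i := fun h' => h (h' ▸ rfl)
    exact ⟨_, mem_overSet.2 ⟨_, h1, _, h2, by simp, Or.inr (hsi i'),
      Or.inr ((hii i' i).resolve_left hne)⟩⟩
  by_cases hx : Sum.inr none ∈ S
  · obtain ⟨v, hv, hv'⟩ : ∃ v ∈ S, v ≠ Sum.inr none := by
      rcases hS (.inr (some 0)) with h | ⟨v, hv, h⟩
      · exact ⟨_, h, by simp⟩
      · refine ⟨v, hv, ?_⟩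
        rintro rfl
        exact hx0 h.symm
    rcases v with s | _ | i
    · exact ⟨_, mem_overSet.2 ⟨_, hx, _, hv, by simp, Or.inl rfl, Or.inr (hxs s)⟩⟩
    · exact absurd rfl hv'
    · exact ⟨_, mem_overSet.2 ⟨_, hx, _, hv, by simp, Or.inr (hxs (f i)).symm,
        Or.inr (hsi i).symm⟩⟩
  · have hdom : ∀ s, Sum.inl s ∈ S ∨ ∃ i, f i = s ∧ Sum.inr (some i) ∈ S := by
      intro s
      rcases hS (.inl s) with h | ⟨v, hv, h⟩
      · exact Or.inl h
      · rcases v with t | _ | i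
        · exact absurd (hle h) (by simp)
        · exact absurd hv hx
        · exact Or.inr ⟨i, by simpa using hle h, hv⟩
    rcases hdom 0 with h0 | ⟨i, hi, h0⟩ <;> rcases hdom 1 with h1 | ⟨i', hi', h1⟩
    · exact ⟨_, mem_overSet.2 ⟨_, h0, _, h1, by simp, Or.inr (hxs 0), Or.inr (hxs 1)⟩⟩
    · exact mixed 0 i' (by simp [hi']) h0 h1
    · exact mixed 1 i (by simp [hi]) h1 h0
    · exact core i i' (by rintro rfl; simp [hi] at hi') h0 h1

lemma exists_isUnitCR {r k j : ℕ} (hr : 2 ≤ r) (hk : 2 ≤ k) (hj : 1 ≤ j) (hjk : j ≤ k) :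
    ∃ G : SimpleGraph (Fin r ⊕ Option (Fin k)),
      G.edgeSet.ncard + j = (k + 1).choose 2 + k + r ∧ IsUnitCR G r := by
  rcases hr.eq_or_lt with rfl | hr
  · exact exists_isUnitCR_two hk hj hjk
  · exact exists_isUnitCR_of_three_le hr hk hj hjk

lemma exists_isUnitCR_fin_five :
    ∃ G : SimpleGraph (Fin 5), G.edgeSet.ncard = 4 ∧ IsUnitCR G 2 := by
  let E : Finset (Sym2 (Fin 5)) := {s(0, 1), s(0, 2), s(0, 3), s(3, 4)}
  let G : SimpleGraph (Fin 5) := SimpleGraph.fromEdgeSet (E : Set (Sym2 (Fin 5)))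
  have hadj : ∀ u v, G.Adj u v ↔ s(u, v) ∈ E ∧ u ≠ v := by
    intro u v
    simp [G]
  have hnot : ∀ u v, G.Adj u v → (u = 1 → v = 0) ∧ (u = 2 → v = 0) ∧ (u = 4 → v = 3) ∧
      (u = 0 → v ≠ 4) ∧ (v = 4 → u = 3) := by
    simp only [hadj]
    decide
  have h01 : G.Adj 0 1 := (hadj _ _).2 (by decide)
  have h02 : G.Adj 0 2 := (hadj _ _).2 (by decide)
  have h03 : G.Adj 0 3 := (hadj _ _).2 (by decide)
  have h34 : G.Adj 3 4 := (hadj _ _).2 (by decide)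
  refine ⟨G, ?_, ⟨{0, 4}, isDomSet_iff.2 fun v => ?_,
    crOf_le_one (x := 3) fun v hv => ?_, by rw [Set.ncard_pair (by decide)]⟩, fun S hS _ => ?_⟩
  · have : G.edgeSet = (E : Set (Sym2 (Fin 5))) := by
      rw [SimpleGraph.edgeSet_fromEdgeSet, sdiff_eq_left, Set.disjoint_left]
      intro e he
      have : ∀ e ∈ E, ¬ e.IsDiag := by decide
      exact this e he
    rw [this, Set.ncard_coe_finset]
    decide
  · fin_cases v
    · exact Or.inl (by simp)
    · exact Or.inr ⟨0, by simp, h01.symm⟩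
    · exact Or.inr ⟨0, by simp, h02.symm⟩
    · exact Or.inr ⟨0, by simp, h03.symm⟩
    · exact Or.inl (by simp)
  · obtain ⟨s, hs, t, ht, hst, h1, h2⟩ := mem_overSet.1 hv
    simp only [Set.mem_insert_iff, Set.mem_singleton_iff] at hs ht
    have g1 := fun h => hnot v s h
    have g2 := fun h => hnot v t h
    grind
  · suffices h : ∃ v, v ∈ overSet G S by
      obtain ⟨v, hv⟩ := h
      exact ⟨crOf_pos hv, two_le_ncard_of_mem_overSet hv⟩
    rw [isDomSet_iff] at hS
    by_cases h0 : (0 : Fin 5) ∈ S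
    · rcases hS 4 with h4 | ⟨v, hv, h⟩
      · exact ⟨3, mem_overSet.2 ⟨0, h0, 4, h4, by decide, Or.inr h03.symm, Or.inr h34⟩⟩
      · obtain rfl := (hnot _ _ h).2.2.1 rfl
        exact ⟨0, mem_overSet.2 ⟨0, h0, 3, hv, by decide, Or.inl rfl, Or.inr h03⟩⟩
    · have h1 : (1 : Fin 5) ∈ S := by
        rcases hS 1 with h | ⟨v, hv, h⟩
        · exact h
        · exact absurd ((hnot _ _ h).1 rfl ▸ hv) h0
      have h2 : (2 : Fin 5) ∈ S := by
        rcases hS 2 with h | ⟨v, hv, h⟩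
        · exact h
        · exact absurd ((hnot _ _ h).2.1 rfl ▸ hv) h0
      exact ⟨0, mem_overSet.2 ⟨1, h1, 2, h2, by decide, Or.inr h01, Or.inr h02⟩⟩

theorem D_n_one_m (n m : ℕ) (hn : 5 ≤ n) :
    ((4 ≤ m ∧ m ≤ n + 1) →
      (∀ (V : Type) [Fintype V] (G : SimpleGraph V), Fintype.card V = n →
          G.edgeSet.ncard = m → crNum G = 1 → gammaCR G ≤ n - 3) ∧
      (∃ G : SimpleGraph (Fin n), G.edgeSet.ncard = m ∧ crNum G = 1 ∧
          gammaCR G = n - 3)) ∧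
    (∀ r : ℕ,
      (n + 2 ≤ m ∧ m ≤ (n - 1).choose 2 ∧
        (n - (r + 1)).choose 2 + (n - 2) < m ∧ m ≤ (n - r).choose 2 + (n - 2)) →
      (∀ (V : Type) [Fintype V] (G : SimpleGraph V), Fintype.card V = n →
          G.edgeSet.ncard = m → crNum G = 1 → gammaCR G ≤ r) ∧
      (∃ G : SimpleGraph (Fin n), G.edgeSet.ncard = m ∧ crNum G = 1 ∧
          gammaCR G = r)) ∧
    ((n - 1).choose 2 < m →
      ∀ (V : Type) [Fintype V] (G : SimpleGraph V), Fintype.card V = n →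
        G.edgeSet.ncard = m → crNum G ≠ 1) := by
  refine ⟨?_, ?_, ?_⟩
  · rintro ⟨hm, hmn⟩
    refine ⟨fun V _ G hV _ hG => hV ▸ gammaCR_le_card_sub_three hG, ?_⟩
    obtain rfl | rfl | hm6 : m = 4 ∨ m = 5 ∨ 6 ≤ m := by omega
    · obtain ⟨G, hG, h⟩ := exists_isUnitCR_fin_five
      obtain ⟨H, h1, h2, h3⟩ := exists_fin_of_isUnitCR h (n := n) (by simpa using hn)
      exact ⟨H, h1.trans hG, h2, h3.trans (by rw [Fintype.card_fin]; omega)⟩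
    · obtain ⟨G, hG, h⟩ :=
        exists_isUnitCR (r := 2) (k := 2) (j := 2) le_rfl le_rfl (by norm_num) le_rfl
      have hc : Fintype.card (Fin 2 ⊕ Option (Fin 2)) = 5 := by simp
      obtain ⟨H, h1, h2, h3⟩ := exists_fin_of_isUnitCR h (n := n) (by omega)
      have h4 : (2 + 1).choose 2 = 3 := rfl
      exact ⟨H, by omega, h2, by omega⟩
    · obtain ⟨G, hG, h⟩ :=
        exists_isUnitCR (r := m - 4) (k := 2) (j := 1) (by omega) le_rfl le_rfl (by norm_num)
      have hc : Fintype.card (Fin (m - 4) ⊕ Option (Fin 2)) = m - 4 + 3 := by simp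
      obtain ⟨H, h1, h2, h3⟩ := exists_fin_of_isUnitCR h (n := n) (by omega)
      have h4 : (2 + 1).choose 2 = 3 := rfl
      exact ⟨H, by omega, h2, by omega⟩
  · rintro r ⟨hm, hm1, hlow, hupp⟩
    refine ⟨fun V _ G hV hE hG => ?_, ?_⟩
    · obtain ⟨S, hS, h1, h2⟩ := exists_ncard_eq_gammaCR G
      have h3 := ncard_edgeSet_add_one_le hG hS (h1.trans hG)
      rw [hV, hE, h2] at h3
      by_contra! hlt
      have : (n - gammaCR G).choose 2 ≤ (n - (r + 1)).choose 2 :=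
        Nat.choose_le_choose 2 (by omega)
      omega
    · have hstep1 := choose_two_step (n - 2)
      rw [show n - 2 + 1 = n - 1 by omega] at hstep1
      have hr : 2 ≤ r := by
        by_contra! hlt
        have : (n - 2).choose 2 ≤ (n - (r + 1)).choose 2 := Nat.choose_le_choose 2 (by omega)
        omega
      have hnr : 4 ≤ n - r := by
        by_contra! hlt
        have : (n - r).choose 2 ≤ (3).choose 2 := Nat.choose_le_choose 2 (by omega)
        have h3 : (3).choose 2 = 3 := rfl
        omega
      obtain ⟨k, hk⟩ : ∃ k, n = r + (k + 1) := ⟨n - r - 1, by omega⟩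
      rw [show n - r = k + 1 by omega] at hupp
      rw [show n - (r + 1) = k by omega] at hlow
      have hstep2 := choose_two_step k
      obtain ⟨G, hG, h⟩ := exists_isUnitCR (r := r) (k := k)
        (j := (k + 1).choose 2 + k + r - m) hr (by omega) (by omega) (by omega)
      have hc : Fintype.card (Fin r ⊕ Option (Fin k)) = n := by simp [hk]
      obtain ⟨H, h1, h2, h3⟩ := exists_fin_of_isUnitCR h (n := n) hc.le
      exact ⟨H, by omega, h2, by omega⟩
  · intro hm V _ G hV hE hG
    obtain ⟨S, hS, h1⟩ := exists_crOf_eq_crNum G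
    rw [hG] at h1
    have h2 := ncard_edgeSet_add_one_le hG hS h1
    rw [hV, hE] at h2
    obtain ⟨-, x, -, -, a, ha, b, hb, hab, hxa, hxb⟩ := exists_overdominated hS h1
    have h3 := two_le_ncard_of_mem_overSet
      (mem_overSet.2 ⟨a, ha, b, hb, hab, Or.inr hxa, Or.inr hxb⟩)
    have h4 : (n - S.ncard).choose 2 ≤ (n - 2).choose 2 := Nat.choose_le_choose 2 (by omega)
    have hstep := choose_two_step (n - 2)
    rw [show n - 2 + 1 = n - 1 by omega] at hstep
    omega
end
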